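/- Let r ∈ ℕ^m, c ∈ ℕ^n with equal coordinate sums and let M1, M2 ∈ BCT(r,c). If M1 ≤_{secB} M2 in the combinatorial secondary Bruhat order, then M1 ≤_B M2 in the combinatorial Bruhat order, i.e. σ(M1)_{ij} ≥ σ(M2)_{ij} for all i,j. -/

import Mathlib

open Finset

/-- `M` is a 0-1 matrix with row sum vector `r` and column sum vector `c`. -/
def isBCT {m n : ℕ} (r : Fin m → ℕ) (c : Fin n → ℕ) (M : Fin m → Fin n → ℕ) : Prop :=
  (∀ i j, M i j = 0 ∨ M i j = 1) ∧ (∀ i, ∑ j, M i j = r i) ∧ (∀ j, ∑ i, M i j = c j)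

/-- `M'` is obtained from `M` by a single `L2 → I2` interchange. -/
def InterchangeStep {m n : ℕ} (M M' : Fin m → Fin n → ℕ) : Prop :=
  ∃ (i j : Fin m) (k l : Fin n), i < j ∧ k < l ∧
    M i k = 0 ∧ M i l = 1 ∧ M j k = 1 ∧ M j l = 0 ∧
    M' i k = 1 ∧ M' i l = 0 ∧ M' j k = 0 ∧ M' j l = 1 ∧
    (∀ p q, ¬((p = i ∨ p = j) ∧ (q = k ∨ q = l)) → M' p q = M p q)

/-- The combinatorial secondary Bruhat order: `M1 ≤ M2` iff `M1` is obtained from `M2`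
by a (possibly empty) finite sequence of `L2 → I2` interchanges. -/
def secBLE {m n : ℕ} (M1 M2 : Fin m → Fin n → ℕ) : Prop :=
  Relation.ReflTransGen InterchangeStep M2 M1

/-- `σ(M)_{ij} = ∑_{k ≤ i} ∑_{l ≤ j} m_{kl}`. -/
def sigmaM {m n : ℕ} (M : Fin m → Fin n → ℕ) (i : Fin m) (j : Fin n) : ℕ :=
  ∑ k ∈ Finset.univ.filter (fun k : Fin m => k ≤ i),
    ∑ l ∈ Finset.univ.filter (fun l : Fin n => l ≤ j), M k l

/-- The combinatorial Bruhat order: `M1 ≤_B M2` iff `σ(M1) ≥ σ(M2)` entrywise. -/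
def bruhatLE {m n : ℕ} (M1 M2 : Fin m → Fin n → ℕ) : Prop :=
  ∀ i j, sigmaM M2 i j ≤ sigmaM M1 i j

/-- A single interchange adds to `M` the product of two differences of indicator functions. -/
theorem InterchangeStep.exists_eq_add_mul {m n : ℕ} {M M' : Fin m → Fin n → ℕ}
    (h : InterchangeStep M M') :
    ∃ (i j : Fin m) (k l : Fin n), i < j ∧ k < l ∧ ∀ p q, (M' p q : ℤ) = M p q +
      ((if p = i then 1 else 0) - (if p = j then 1 else 0)) *
        ((if q = k then 1 else 0) - (if q = l then 1 else 0)) := by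
  obtain ⟨i, j, k, l, hij, hkl, h₁, h₂, h₃, h₄, h₅, h₆, h₇, h₈, hrest⟩ := h
  refine ⟨i, j, k, l, hij, hkl, fun p q => ?_⟩
  have := hij.ne
  have := hkl.ne
  have := hrest p q
  grind

/-- The sum over an initial segment of a difference of indicators at `i < j` is nonnegative. -/
theorem sum_le_indicator_sub_nonneg {m : ℕ} {i j : Fin m} (hij : i < j) (a : Fin m) :
    (0 : ℤ) ≤ ∑ p ∈ Finset.univ.filter (fun p : Fin m => p ≤ a),
      ((if p = i then 1 else 0) - (if p = j then 1 else 0)) := by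
  have hle : j ≤ a → i ≤ a := hij.le.trans
  simp only [Finset.sum_sub_distrib, Finset.sum_ite_eq', Finset.mem_filter, Finset.mem_univ,
    true_and]
  grind

/-- A single interchange goes down in the Bruhat order. -/
theorem InterchangeStep.bruhatLE {m n : ℕ} {M M' : Fin m → Fin n → ℕ}
    (h : InterchangeStep M M') : bruhatLE M' M := by
  obtain ⟨i, j, k, l, hij, hkl, hM⟩ := h.exists_eq_add_mul
  intro a b
  zify [sigmaM]
  simp only [hM, Finset.sum_add_distrib, ← Finset.mul_sum, ← Finset.sum_mul]
  exact le_add_of_nonneg_right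
    (mul_nonneg (sum_le_indicator_sub_nonneg hij a) (sum_le_indicator_sub_nonneg hkl b))

/-- The combinatorial secondary Bruhat order refines the combinatorial Bruhat order. -/
theorem secB_implies_B {m n : ℕ} (r : Fin m → ℕ) (c : Fin n → ℕ)
    (hsum : ∑ i, r i = ∑ j, c j)
    (M1 M2 : Fin m → Fin n → ℕ) (h1 : isBCT r c M1) (h2 : isBCT r c M2)
    (h : secBLE M1 M2) : bruhatLE M1 M2 := by
  clear h1
  induction h with
  | refl => exact fun _ _ => le_rfl
  | tail _ hstep ih => exact fun i j => (ih i j).trans (hstep.bruhatLE i j)
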